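/- For every natural number k and every complex number z, the following identity holds: ∑_{p=0}^{k} [ (1/(k−p)!)·∏_{β=1}^{k−p} (z − β + 1) ] · [ (1/p!)·∏_{β=1}^{p} (z − 2k + p − β) ] = (2^k / k!)·∏_{α=1}^{k} (z − 2α + 1). -/

import Mathlib

/-- Generalized binomial coefficient. -/
noncomputable def cc (z : ℂ) (j : ℕ) : ℂ := (1 / (Nat.factorial j : ℂ)) * ∏ i ∈ Finset.range j, (z - i)

/-- Generalized multichoose coefficient. -/
noncomputable def dd (w : ℂ) (j : ℕ) : ℂ := (1 / (Nat.factorial j : ℂ)) * ∏ i ∈ Finset.range j, (w + i)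

lemma cc_succ (z : ℂ) (j : ℕ) : cc z (j + 1) * (j + 1) = z * cc (z - 1) j := by
  unfold cc
  rw [Finset.prod_range_succ', Nat.factorial_succ]
  have h : ∏ i ∈ Finset.range j, (z - ((i + 1 : ℕ) : ℂ)) = ∏ i ∈ Finset.range j, (z - 1 - i) :=
    Finset.prod_congr rfl fun i _ => by push_cast; ring
  rw [h]
  have h1 : ((j : ℂ) + 1) ≠ 0 := by exact_mod_cast Nat.succ_ne_zero j
  have h2 : (Nat.factorial j : ℂ) ≠ 0 := by exact_mod_cast Nat.factorial_ne_zero j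
  push_cast
  field_simp
  ring

lemma cc_succ' (z : ℂ) (j : ℕ) : cc z (j + 1) * (j + 1) = (z - j) * cc z j := by
  unfold cc
  rw [Finset.prod_range_succ, Nat.factorial_succ]
  have h1 : ((j : ℂ) + 1) ≠ 0 := by exact_mod_cast Nat.succ_ne_zero j
  have h2 : (Nat.factorial j : ℂ) ≠ 0 := by exact_mod_cast Nat.factorial_ne_zero j
  push_cast
  field_simp

lemma dd_eq (w : ℂ) (j : ℕ) : dd w j = (-1) ^ j * cc (-w) j := by
  unfold dd cc
  have : ∏ i ∈ Finset.range j, (w + i) = (-1) ^ j * ∏ i ∈ Finset.range j, (-w - (i : ℂ)) := by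
    rw [← Finset.card_range j, ← Finset.prod_const, Finset.card_range, ← Finset.prod_mul_distrib]
    exact Finset.prod_congr rfl fun i _ => by ring
  rw [this]; ring

lemma cc_pascal (z : ℂ) (j : ℕ) : cc z (j + 1) = cc (z - 1) (j + 1) + cc (z - 1) j := by
  have h1 : ((j : ℂ) + 1) ≠ 0 := by exact_mod_cast Nat.succ_ne_zero j
  apply mul_right_cancel₀ h1
  rw [add_mul, cc_succ, cc_succ']
  ring

lemma dd_succ (w : ℂ) (j : ℕ) : dd w (j + 1) * (j + 1) = w * dd (w + 1) j := by
  have := cc_succ (-w) j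
  rw [dd_eq, dd_eq, show -(w + 1) = -w - 1 by ring]
  linear_combination (-1) ^ (j + 1) * this

lemma dd_pascal (w : ℂ) (j : ℕ) : dd (w + 1) (j + 1) = dd w (j + 1) + dd (w + 1) j := by
  have := cc_pascal (-w) j
  rw [dd_eq, dd_eq, dd_eq, show -(w + 1) = -w - 1 by ring]
  linear_combination (-1) ^ j * this

/-- `(1+X)^z` -/
noncomputable def BB (z : ℂ) : PowerSeries ℂ := PowerSeries.mk (cc z)
/-- `(1-X)^(-w)` -/
noncomputable def DD (w : ℂ) : PowerSeries ℂ := PowerSeries.mk (dd w)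

lemma BB_mul (z : ℂ) : BB z = (1 + PowerSeries.X) * BB (z - 1) := by
  ext n
  rw [add_mul, one_mul, map_add]
  cases n with
  | zero => simp [BB, cc]
  | succ n => simp [BB, PowerSeries.coeff_succ_X_mul, cc_pascal z n]

lemma DD_mul (w : ℂ) : DD w = (1 - PowerSeries.X) * DD (w + 1) := by
  ext n
  rw [sub_mul, one_mul, map_sub]
  cases n with
  | zero => simp [DD, dd]
  | succ n => simp [DD, PowerSeries.coeff_succ_X_mul, dd_pascal w n]

lemma BB_deriv (z : ℂ) : PowerSeries.derivative ℂ (BB z) = PowerSeries.C z * BB (z - 1) := by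
  ext n
  simp [BB, PowerSeries.coeff_derivative, cc_succ]

lemma DD_deriv (w : ℂ) : PowerSeries.derivative ℂ (DD w) = PowerSeries.C w * DD (w + 1) := by
  ext n
  simp [DD, PowerSeries.coeff_derivative, dd_succ]

lemma key_rec (k : ℕ) (z : ℂ) :
    PowerSeries.coeff (k + 1) (BB z * DD (z - 2 * ((k + 1 : ℕ) : ℂ))) * (k + 1) =
      2 * (z - 1) * PowerSeries.coeff k (BB (z - 2) * DD (z - 2 - 2 * (k : ℂ))) := by
  rw [show z - 2 * ((k + 1 : ℕ) : ℂ) = z - 2 - 2 * (k : ℂ) by push_cast; ring]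
  obtain ⟨w, hw⟩ : ∃ w, w = z - 2 - 2 * (k : ℂ) := ⟨_, rfl⟩
  rw [← hw]
  have hB1 : BB (z - 1) = (1 + PowerSeries.X) * BB (z - 2) := by
    rw [BB_mul (z - 1), show z - 1 - 1 = z - 2 by ring]
  have hB : BB z = (1 + PowerSeries.X) * BB (z - 1) := BB_mul z
  have hD := DD_mul w
  have hf : PowerSeries.derivative ℂ (BB z * DD w) =
      BB z * (PowerSeries.C w * DD (w + 1)) + DD w * (PowerSeries.C z * BB (z - 1)) := by
    rw [Derivation.leibniz, BB_deriv, DD_deriv]; rfl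
  have hh : PowerSeries.derivative ℂ (BB (z - 1) * DD w) =
      BB (z - 1) * (PowerSeries.C w * DD (w + 1)) +
        DD w * (PowerSeries.C (z - 1) * BB (z - 2)) := by
    rw [Derivation.leibniz, BB_deriv, DD_deriv, show z - 1 - 1 = z - 2 by ring]; rfl
  have hx : PowerSeries.coeff k (PowerSeries.X * PowerSeries.derivative ℂ (BB (z - 1) * DD w)) =
      PowerSeries.coeff k (PowerSeries.C (k : ℂ) * (BB (z - 1) * DD w)) := by
    cases k with
    | zero => simp
    | succ n =>
      rw [PowerSeries.coeff_succ_X_mul, PowerSeries.coeff_derivative, PowerSeries.coeff_C_mul]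
      push_cast; ring
  have hmain : PowerSeries.derivative ℂ (BB z * DD w) =
      PowerSeries.C (2 * (z - 1)) * (BB (z - 2) * DD w) +
      PowerSeries.C 2 * (PowerSeries.X * PowerSeries.derivative ℂ (BB (z - 1) * DD w) -
        PowerSeries.C (k : ℂ) * (BB (z - 1) * DD w)) := by
    rw [hf, hh, hB, hB1, hD, hw]
    simp only [map_mul, map_sub, map_one, show PowerSeries.C (2 : ℂ) = 2 from map_ofNat _ 2]
    ring
  have := congrArg (PowerSeries.coeff k) hmain
  rw [PowerSeries.coeff_derivative, map_add, PowerSeries.coeff_C_mul, PowerSeries.coeff_C_mul,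
    map_sub, hx] at this
  rw [this]; ring

lemma key_closed (k : ℕ) (z : ℂ) :
    PowerSeries.coeff k (BB z * DD (z - 2 * (k : ℂ))) =
      (2 ^ k / (Nat.factorial k : ℂ)) * ∏ i ∈ Finset.range k, (z - 2 * ((1 + i : ℕ) : ℂ) + 1) := by
  induction k generalizing z with
  | zero => simp [BB, DD, cc, dd]
  | succ k ih =>
    have h1 : ((k : ℂ) + 1) ≠ 0 := by exact_mod_cast Nat.succ_ne_zero k
    have h2 : (Nat.factorial k : ℂ) ≠ 0 := by exact_mod_cast Nat.factorial_ne_zero k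
    apply mul_right_cancel₀ h1
    rw [key_rec, ih, Finset.prod_range_succ', Nat.factorial_succ]
    have h : ∏ i ∈ Finset.range k, (z - 2 * ((1 + (i + 1) : ℕ) : ℂ) + 1) =
        ∏ i ∈ Finset.range k, (z - 2 - 2 * ((1 + i : ℕ) : ℂ) + 1) :=
      Finset.prod_congr rfl fun i _ => by push_cast; ring
    rw [h]
    push_cast
    field_simp
    ring

lemma prod_Icc_one (f : ℕ → ℂ) (n : ℕ) :
    ∏ i ∈ Finset.Icc 1 n, f i = ∏ i ∈ Finset.range n, f (1 + i) := by
  rw [← Finset.Ico_add_one_right_eq_Icc, Finset.prod_Ico_eq_prod_range, Nat.add_sub_cancel]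


/-- Lemma (sequence_property1): the polynomial identity
`∑_{p=0}^{k} [∏_{β=1}^{k−p}(z−β+1)/(k−p)!]·[∏_{β=1}^{p}(z−2k+p−β)/p!]
  = (2^k/k!)·∏_{α=1}^{k}(z−2α+1)`. -/
theorem sequence_property1 (k : ℕ) (z : ℂ) :
    ∑ p ∈ Finset.range (k + 1),
      ((1 / (Nat.factorial (k - p) : ℂ)) *
          ∏ β ∈ Finset.Icc 1 (k - p), (z - (β : ℂ) + 1)) *
        ((1 / (Nat.factorial p : ℂ)) *
          ∏ β ∈ Finset.Icc 1 p, (z - 2 * (k : ℂ) + (p : ℂ) - (β : ℂ))) =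
      (2 ^ k / (Nat.factorial k : ℂ)) *
        ∏ α ∈ Finset.Icc 1 k, (z - 2 * (α : ℂ) + 1) := by

  rw [prod_Icc_one (fun α => z - 2 * (α : ℂ) + 1), ← key_closed, mul_comm (BB z),
    PowerSeries.coeff_mul, Finset.Nat.sum_antidiagonal_eq_sum_range_succ_mk]
  refine Finset.sum_congr rfl fun p _ => ?_
  simp only [BB, DD, PowerSeries.coeff_mk]
  rw [mul_comm]
  congr 1
  · unfold dd
    congr 1
    rw [prod_Icc_one (fun β => z - 2 * (k : ℂ) + (p : ℂ) - (β : ℂ)), ← Finset.prod_range_reflect]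
    refine Finset.prod_congr rfl fun i hi => ?_
    have : 1 + (p - 1 - i) + i = p := by have := Finset.mem_range.1 hi; omega
    have h : ((1 + (p - 1 - i) : ℕ) : ℂ) + i = p := by exact_mod_cast this
    linear_combination -h
  · unfold cc
    congr 1
    rw [prod_Icc_one (fun β => z - (β : ℂ) + 1)]
    exact Finset.prod_congr rfl fun i _ => by push_cast; ring
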